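/- arXiv:2408.01798 — 2 statements merged into one kernel-verified Lean document; each statement's English description precedes it below -/
import Mathlib

section
/- Uncrossing with slack: Let (V, w) be a weighted graph, let A, B ⊆ V be disjoint nonempty sets, and let λ(A,B) = min{w(X) : X ⊆ V, A ⊆ X, X ∩ B = ∅}. Suppose C ⊆ V satisfies A ⊆ C, C ∩ B = ∅, and w(C) ≤ λ(A,B) + Δ for a real Δ. Then every S ⊆ V with S ∩ B = ∅ satisfies w(S ∩ C) ≤ w(S) + Δ. -/
open Finset

/-- Cut value of a set `S` in a weighted graph on a finite vertex type `V`. -/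
def cutVal {V : Type*} [Fintype V] [DecidableEq V] (w : V → V → ℝ) (S : Finset V) : ℝ :=
  ∑ u ∈ S, ∑ v ∈ Sᶜ, w u v

/-- Minimum `A`-`B` cut value: the infimum of cut values over sets containing `A`
and disjoint from `B`. -/
noncomputable def minCutSets {V : Type*} [Fintype V] [DecidableEq V]
    (w : V → V → ℝ) (A B : Finset V) : ℝ :=
  sInf {x : ℝ | ∃ X : Finset V, A ⊆ X ∧ X ∩ B = ∅ ∧ cutVal w X = x}

theorem cutVal_eq_sum_ite {V : Type*} [Fintype V] [DecidableEq V] (w : V → V → ℝ)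
    (S : Finset V) :
    cutVal w S = ∑ u, ∑ v, if u ∈ S ∧ v ∉ S then w u v else 0 := by
  simp only [cutVal, ite_and, ← mem_compl, sum_ite_irrel, sum_const_zero, sum_ite_mem, univ_inter]

theorem cutVal_nonneg {V : Type*} [Fintype V] [DecidableEq V] {w : V → V → ℝ}
    (hw : ∀ u v, 0 ≤ w u v) (S : Finset V) : 0 ≤ cutVal w S :=
  sum_nonneg fun u _ => sum_nonneg fun v _ => hw u v

/-- The cut function of a nonnegative weight is submodular. -/
theorem cutVal_inter_add_cutVal_union_le {V : Type*} [Fintype V] [DecidableEq V]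
    {w : V → V → ℝ} (hw : ∀ u v, 0 ≤ w u v) (S T : Finset V) :
    cutVal w (S ∩ T) + cutVal w (S ∪ T) ≤ cutVal w S + cutVal w T := by
  simp only [cutVal_eq_sum_ite, ← sum_add_distrib]
  refine sum_le_sum fun u _ => sum_le_sum fun v _ => ?_
  have := hw u v
  by_cases u ∈ S <;> by_cases u ∈ T <;> by_cases v ∈ S <;> by_cases v ∈ T <;> simp [*]

theorem minCutSets_le_cutVal {V : Type*} [Fintype V] [DecidableEq V] {w : V → V → ℝ}
    (hw : ∀ u v, 0 ≤ w u v) {A B X : Finset V} (hA : A ⊆ X) (hB : X ∩ B = ∅) :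
    minCutSets w A B ≤ cutVal w X := by
  refine csInf_le ⟨0, ?_⟩ ⟨X, hA, hB, rfl⟩
  rintro _ ⟨Y, -, -, rfl⟩
  exact cutVal_nonneg hw Y

/-- Uncrossing with slack: if `C` is an additively `Δ`-approximate minimum `A`-`B`
cut, then intersecting any `B`-avoiding set `S` with `C` increases the cut value
by at most `Δ`. -/
theorem uncross_with_slack {V : Type*} [Fintype V] [DecidableEq V] (w : V → V → ℝ)
    (hsymm : ∀ u v, w u v = w v u) (hnonneg : ∀ u v, 0 ≤ w u v)
    (hdiag : ∀ u, w u u = 0)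
    (A B : Finset V) (hAB : Disjoint A B) (hA : A.Nonempty) (hB : B.Nonempty)
    (C : Finset V) (hAC : A ⊆ C) (hCB : C ∩ B = ∅)
    (Δ : ℝ) (hC : cutVal w C ≤ minCutSets w A B + Δ)
    (S : Finset V) (hSB : S ∩ B = ∅) :
    cutVal w (S ∩ C) ≤ cutVal w S + Δ := by
  have hunion : minCutSets w A B ≤ cutVal w (S ∪ C) :=
    minCutSets_le_cutVal hnonneg (hAC.trans subset_union_right)
      (by rw [union_inter_distrib_right, hSB, hCB, union_empty])
  linarith [cutVal_inter_add_cutVal_union_le hnonneg S C]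
end

section
/- At most n−1 distinct pairwise min-cut values (Gomory–Hu): For every weighted graph (V, w) with |V| = n ≥ 2, the set of values {λ(s,t) : s, t ∈ V, s ≠ t} has at most n − 1 elements. -/
open Finset

/-- Minimum `s`-`t` cut value. -/
noncomputable def minCut {V : Type*} [Fintype V] [DecidableEq V] (w : V → V → ℝ) (s t : V) : ℝ :=
  sInf {x : ℝ | ∃ S : Finset V, s ∈ S ∧ t ∉ S ∧ cutVal w S = x}

theorem minCut_le_cutVal {V : Type*} [Fintype V] [DecidableEq V] (w : V → V → ℝ) {s t : V}
    {S : Finset V} (hs : s ∈ S) (ht : t ∉ S) : minCut w s t ≤ cutVal w S := by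
  refine csInf_le (Set.Finite.bddBelow ?_) ⟨S, hs, ht, rfl⟩
  refine (Set.finite_range (cutVal w)).subset ?_
  rintro x ⟨T, -, -, rfl⟩
  exact ⟨T, rfl⟩

theorem le_minCut {V : Type*} [Fintype V] [DecidableEq V] (w : V → V → ℝ) {s t : V}
    (hst : s ≠ t) {c : ℝ} (h : ∀ S : Finset V, s ∈ S → t ∉ S → c ≤ cutVal w S) :
    c ≤ minCut w s t := by
  refine le_csInf ⟨_, {s}, by simp, by simpa using hst.symm, rfl⟩ ?_
  rintro x ⟨S, hs, ht, rfl⟩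
  exact h S hs ht

theorem cutVal_compl {V : Type*} [Fintype V] [DecidableEq V] {w : V → V → ℝ}
    (hsymm : ∀ u v, w u v = w v u) (S : Finset V) : cutVal w Sᶜ = cutVal w S := by
  unfold cutVal
  rw [compl_compl, sum_comm]
  exact sum_congr rfl fun u _ => sum_congr rfl fun v _ => hsymm v u

theorem minCut_le_minCut_swap {V : Type*} [Fintype V] [DecidableEq V] {w : V → V → ℝ}
    (hsymm : ∀ u v, w u v = w v u) {s t : V} (hst : s ≠ t) : minCut w s t ≤ minCut w t s := by
  refine le_minCut w hst.symm fun S ht hs => ?_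
  rw [← cutVal_compl hsymm]
  exact minCut_le_cutVal w (by simpa using hs) (by simpa using ht)

theorem minCut_comm {V : Type*} [Fintype V] [DecidableEq V] {w : V → V → ℝ}
    (hsymm : ∀ u v, w u v = w v u) (s t : V) : minCut w s t = minCut w t s := by
  rcases eq_or_ne s t with rfl | hst
  · rfl
  · exact (minCut_le_minCut_swap hsymm hst).antisymm (minCut_le_minCut_swap hsymm hst.symm)

theorem min_minCut_le_minCut {V : Type*} [Fintype V] [DecidableEq V] (w : V → V → ℝ) {s t : V}
    (r : V) (hst : s ≠ t) : min (minCut w s r) (minCut w r t) ≤ minCut w s t := by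
  refine le_minCut w hst fun S hs ht => ?_
  by_cases hr : r ∈ S
  · exact (min_le_right _ _).trans (minCut_le_cutVal w hr ht)
  · exact (min_le_left _ _).trans (minCut_le_cutVal w hs hr)

/-- A symmetric function satisfying the reversed ultrametric inequality takes at most `#A - 1`
values on pairs of distinct elements of a finite set `A`. -/
theorem card_image_offDiag_le_of_min_le {α β : Type*} [DecidableEq α] [LinearOrder β]
    (f : α → α → β) (hcomm : ∀ a b, f a b = f b a)
    (hmin : ∀ a b c, a ≠ c → min (f a b) (f b c) ≤ f a c) (A : Finset α) :
    #(A.offDiag.image fun p => f p.1 p.2) ≤ #A - 1 := by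
  induction A using Finset.induction_on with
  | empty => simp
  | insert a A ha ih =>
    rcases A.eq_empty_or_nonempty with rfl | hA
    · simp
    obtain ⟨b, hb, hmax⟩ := A.exists_max_image (f a) hA
    have key : ∀ x ∈ A, f a x = f a b ∨ ∃ p ∈ A.offDiag, f p.1 p.2 = f a x := by
      intro x hx
      rcases (hmax x hx).eq_or_lt with h | h
      · exact Or.inl h
      · have hbx : b ≠ x := by rintro rfl; exact h.false
        have hax : a ≠ x := by rintro rfl; exact ha hx
        refine Or.inr ⟨(b, x), by simp [hb, hx, hbx], le_antisymm ?_ ?_⟩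
        · exact (min_le_iff.1 (hmin a b x hax)).resolve_left h.not_ge
        · have := hmin b a x hbx
          rwa [hcomm b a, min_eq_right h.le] at this
    have hsub : (insert a A).offDiag.image (fun p => f p.1 p.2) ⊆
        insert (f a b) (A.offDiag.image fun p => f p.1 p.2) := by
      intro y hy
      obtain ⟨⟨u, v⟩, huv, rfl⟩ := mem_image.1 hy
      obtain ⟨hu, hv, hne⟩ := mem_offDiag.1 huv
      rw [mem_insert, mem_image]
      dsimp only at hu hv hne ⊢
      rcases mem_insert.1 hu with rfl | huA <;> rcases mem_insert.1 hv with rfl | hvA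
      · exact absurd rfl hne
      · exact key v hvA
      · rw [hcomm]
        exact key u huA
      · exact Or.inr ⟨(u, v), mem_offDiag.2 ⟨huA, hvA, hne⟩, rfl⟩
    have hle := (card_le_card hsub).trans (card_insert_le _ _)
    have hpos := hA.card_pos
    rw [card_insert_of_notMem ha]
    omega

/-- Gomory–Hu: a weighted graph on `n ≥ 2` vertices has at most `n − 1` distinct
pairwise min-cut values. -/
theorem card_minCut_values_le {V : Type*} [Fintype V] [DecidableEq V] (w : V → V → ℝ)
    (hsymm : ∀ u v, w u v = w v u) (hnonneg : ∀ u v, 0 ≤ w u v)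
    (hdiag : ∀ u, w u u = 0)
    (hcard : 2 ≤ Fintype.card V) :
    {x : ℝ | ∃ s t : V, s ≠ t ∧ minCut w s t = x}.ncard ≤ Fintype.card V - 1 := by
  have heq : {x : ℝ | ∃ s t : V, s ≠ t ∧ minCut w s t = x} =
      ((univ : Finset V).offDiag.image fun p => minCut w p.1 p.2 : Finset ℝ) := by
    ext x
    simp
  rw [heq, Set.ncard_coe_finset]
  exact card_image_offDiag_le_of_min_le (minCut w) (minCut_comm hsymm)
    (fun _ b _ h => min_minCut_le_minCut w b h) univ
end
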